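/- Assume E[∫_0^T S_t² dt] < ∞ and E[|S_0|] < ∞. Let M_0 := E[∫_0^T S_u du | F_0], let Z := −Φ_0Λ/T + M_0/T, and let N be any square-integrable martingale on [0,T] with N_0 = 0 almost surely. Then for every φ ∈ A_{Φ_0} with E[∫_0^T φ_t² dt] < ∞, one has E[V^{Φ_0,φ}_T] ≤ Φ_0 E[Z − S_0] + (1/(2Λ)) E[∫_0^T (S_t − Z − N_t)² dt], where the right-hand side may equal +∞. -/

import Mathlib

open MeasureTheory Set
open scoped ENNReal

/-- The terminal wealth `V^{Φ₀,φ}_T = -Φ₀ S_0 - ∫_0^T φ_t S_t dt - (Λ/2) ∫_0^T φ_t² dt`. -/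
noncomputable def wealth {Ω : Type*} (T Λ Φ₀ : ℝ) (S φ : ℝ → Ω → ℝ) (ω : Ω) : ℝ :=
  -Φ₀ * S 0 ω - (∫ t in Icc (0:ℝ) T, φ t ω * S t ω)
    - (Λ / 2) * ∫ t in Icc (0:ℝ) T, (φ t ω) ^ 2

/-- The admissible set `𝒜_{Φ₀}`: progressively measurable processes `φ` with
`∫_0^T φ_t² dt < ∞` a.s. and `Φ₀ + ∫_0^T φ_t dt = 0` a.s. -/
def isAdmissible {Ω : Type*} {m0 : MeasurableSpace Ω} (T Φ₀ : ℝ)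
    (ℱ : Filtration ℝ m0) (μ : Measure Ω) (φ : ℝ → Ω → ℝ) : Prop :=
  ProgMeasurable ℱ φ ∧
    (∀ᵐ ω ∂μ, IntegrableOn (fun t => (φ t ω) ^ 2) (Icc (0:ℝ) T)) ∧
    (∀ᵐ ω ∂μ, Φ₀ + ∫ t in Icc (0:ℝ) T, φ t ω = 0)

lemma aux_meas {Ω : Type*} {m0 : MeasurableSpace Ω} (μ : Measure Ω) [IsProbabilityMeasure μ]
    (T : ℝ) (ℱ : Filtration ℝ m0) (S : ℝ → Ω → ℝ) (h : IsStronglyProgressive ℱ S) :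
    AEStronglyMeasurable (fun p : Ω × ℝ => S p.2 p.1)
      (μ.prod (volume.restrict (Icc (0:ℝ) T))) := by
  have h1 := h T
  have h2 : Measurable (fun p : Ω × ℝ => S (min p.2 T) p.1) := by
    have h3 : Measurable[(inferInstance : MeasurableSpace (Iic T)).prod m0]
        (fun p : Iic T × Ω => S p.1 p.2) := by
      refine h1.measurable.mono ?_ le_rfl
      exact sup_le_sup le_rfl (MeasurableSpace.comap_mono (ℱ.le T))
    have h4 : Measurable (fun p : Ω × ℝ => ((⟨min p.2 T, mem_Iic.2 (min_le_right _ _)⟩ : Iic T), p.1)) := by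
      fun_prop
    exact h3.comp h4
  refine ⟨_, h2.stronglyMeasurable, ?_⟩
  have h5 : ∀ᵐ p ∂(μ.prod (volume.restrict (Icc (0:ℝ) T))), p.2 ∈ Icc (0:ℝ) T :=
    Measure.quasiMeasurePreserving_snd.ae (ae_restrict_mem measurableSet_Icc)
  filter_upwards [h5] with p hp
  rw [min_eq_left hp.2]

lemma aux_memLp {Ω : Type*} {m0 : MeasurableSpace Ω} (μ : Measure Ω) [IsProbabilityMeasure μ]
    (ν : Measure ℝ) [SFinite ν] (f : Ω × ℝ → ℝ) (hf : AEStronglyMeasurable f (μ.prod ν))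
    (h : ∫⁻ ω, (∫⁻ t, ENNReal.ofReal (f (ω, t) ^ 2) ∂ν) ∂μ < ⊤) :
    MemLp f 2 (μ.prod ν) := by
  rw [memLp_two_iff_integrable_sq hf]
  refine ⟨hf.pow 2, ?_⟩
  have hm : AEMeasurable (fun p => ENNReal.ofReal (f p ^ 2)) (μ.prod ν) :=
    (hf.pow 2).aemeasurable.ennreal_ofReal
  rw [hasFiniteIntegral_iff_ofReal (Filter.Eventually.of_forall fun p => sq_nonneg _),
    lintegral_prod _ hm]
  exact h

lemma aux_sq {Ω : Type*} {m0 : MeasurableSpace Ω} (μ : Measure Ω) (f : Ω → ℝ) :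
    ∫⁻ ω, ENNReal.ofReal (f ω ^ 2) ∂μ = eLpNorm f 2 μ ^ (2:ℝ) := by
  have := eLpNorm_nnreal_pow_eq_lintegral (μ := μ) (f := f) (p := 2) (by norm_num)
  simp only [NNReal.coe_ofNat, ENNReal.coe_ofNat] at this
  rw [this]
  refine lintegral_congr fun ω => ?_
  rw [← ofReal_norm, ENNReal.ofReal_rpow_of_nonneg (norm_nonneg _) (by norm_num)]
  simp

/-- Assume `E[∫_0^T S_t² dt] < ∞` and `E[|S_0|] < ∞`.  Let
`M₀ := E[∫_0^T S_u du | ℱ_0]`, let `Z := -Φ₀Λ/T + M₀/T`, and let `N` be any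
square-integrable martingale on `[0,T]` with `N_0 = 0` a.s.  Then for every
`φ ∈ 𝒜_{Φ₀}` with `E[∫_0^T φ_t² dt] < ∞`,
`E[V^{Φ₀,φ}_T] ≤ Φ₀ E[Z - S_0] + (1/(2Λ)) E[∫_0^T (S_t - Z - N_t)² dt]`,
where the right-hand side may equal `+∞` (the inequality is stated in `EReal`). -/
theorem stmt_5
    {Ω : Type*} {m0 : MeasurableSpace Ω} {μ : Measure Ω} [IsProbabilityMeasure μ]
    (T : ℝ) (hT : 0 < T) (Λ : ℝ) (hΛ : 0 < Λ) (Φ₀ : ℝ)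
    (ℱ : Filtration ℝ m0)
    (S : ℝ → Ω → ℝ)
    (hprog : ProgMeasurable ℱ S)
    (hS2 : ∫⁻ ω, (∫⁻ t in Icc (0:ℝ) T, ENNReal.ofReal ((S t ω) ^ 2)) ∂μ < ⊤)
    (hS0 : Integrable (S 0) μ)
    -- `N` is a jointly measurable square-integrable martingale with `N_0 = 0`:
    (N : ℝ → Ω → ℝ)
    (hNmeas : Measurable (Function.uncurry N))
    (hNT2 : Integrable (fun ω => (N T ω) ^ 2) μ)
    (hNmart : ∀ t ∈ Icc (0:ℝ) T, N t =ᵐ[μ] μ[N T | ℱ t])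
    (hN0 : N 0 =ᵐ[μ] fun _ => 0)
    -- `M₀ = E[∫_0^T S_u du | ℱ_0]` and `Z = -Φ₀Λ/T + M₀/T`:
    (M₀ : Ω → ℝ)
    (hM₀ : M₀ = μ[(fun ω => ∫ t in Icc (0:ℝ) T, S t ω) | ℱ 0])
    (Z : Ω → ℝ)
    (hZ : Z = fun ω => -Φ₀ * Λ / T + M₀ ω / T)
    (φ : ℝ → Ω → ℝ)
    (hφ : isAdmissible T Φ₀ ℱ μ φ)
    (hφ2 : ∫⁻ ω, (∫⁻ t in Icc (0:ℝ) T, ENNReal.ofReal ((φ t ω) ^ 2)) ∂μ < ⊤) :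
    ((∫ ω, wealth T Λ Φ₀ S φ ω ∂μ : ℝ) : EReal)
      ≤ ((Φ₀ * ∫ ω, (Z ω - S 0 ω) ∂μ : ℝ) : EReal)
        + ((1 / (2 * Λ) : ℝ) : EReal) *
          ((∫⁻ ω, (∫⁻ t in Icc (0:ℝ) T,
            ENNReal.ofReal ((S t ω - Z ω - N t ω) ^ 2)) ∂μ : ℝ≥0∞) : EReal) := by
  set ν := volume.restrict (Icc (0:ℝ) T) with hν
  set π := μ.prod ν with hπ
  obtain ⟨hφp, -, hφ0⟩ := hφ
  have hSL : MemLp (fun p : Ω × ℝ => S p.2 p.1) 2 π :=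
    aux_memLp μ ν _ (aux_meas μ T ℱ S hprog) hS2
  have hφL : MemLp (fun p : Ω × ℝ => φ p.2 p.1) 2 π :=
    aux_memLp μ ν _ (aux_meas μ T ℱ φ hφp) hφ2
  have hNm : Measurable (fun p : Ω × ℝ => N p.2 p.1) := hNmeas.comp measurable_swap
  have hNTm : Measurable (N T) := hNmeas.comp measurable_prodMk_left
  have hNTL : MemLp (N T) 2 μ :=
    (memLp_two_iff_integrable_sq hNTm.aestronglyMeasurable).2 hNT2
  have hNTi : Integrable (N T) μ := hNTL.integrable (by norm_num)
  have hNL : MemLp (fun p : Ω × ℝ => N p.2 p.1) 2 π := by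
    refine aux_memLp μ ν _ hNm.aestronglyMeasurable ?_
    rw [lintegral_lintegral_swap (by
      exact (hNm.pow_const 2).ennreal_ofReal.aemeasurable)]
    calc ∫⁻ t, ∫⁻ ω, ENNReal.ofReal (N t ω ^ 2) ∂μ ∂ν
        ≤ ∫⁻ t, eLpNorm (N T) 2 μ ^ (2:ℝ) ∂ν := by
          refine lintegral_mono_ae ?_
          filter_upwards [ae_restrict_mem measurableSet_Icc] with t ht
          rw [aux_sq, eLpNorm_congr_ae (hNmart t ht)]
          gcongr
          exact eLpNorm_condExp_le_eLpNorm _ (by norm_num)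
      _ < ⊤ := by
          rw [lintegral_const]
          exact ENNReal.mul_lt_top (ENNReal.rpow_lt_top_of_nonneg (by norm_num) hNTL.2.ne)
            (measure_lt_top _ _)
  have hφS : Integrable (fun p : Ω × ℝ => φ p.2 p.1 * S p.2 p.1) π := hφL.integrable_mul hSL
  have hφN : Integrable (fun p : Ω × ℝ => φ p.2 p.1 * N p.2 p.1) π := hφL.integrable_mul hNL
  have hφφ : Integrable (fun p : Ω × ℝ => φ p.2 p.1 ^ 2) π := hφL.integrable_sq
  have hφi : Integrable (fun p : Ω × ℝ => φ p.2 p.1) π := hφL.integrable (by norm_num)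
  have hNTπ : MemLp (fun p : Ω × ℝ => N T p.1) 2 π := by
    exact hNTL.comp_fst ν
  have hφNT : Integrable (fun p : Ω × ℝ => φ p.2 p.1 * N T p.1) π := hφL.integrable_mul hNTπ
  have hENT : ∫ ω, N T ω ∂μ = 0 := by
    rw [← integral_condExp (ℱ.le 0), ← integral_congr_ae (hNmart 0 ⟨le_rfl, hT.le⟩),
      integral_congr_ae hN0]
    simp
  have hφNzero : ∫ ω, ∫ t, φ t ω * N t ω ∂ν ∂μ = 0 := by
    have e1 : ∫ ω, ∫ t, φ t ω * N t ω ∂ν ∂μ = ∫ ω, ∫ t, φ t ω * N T ω ∂ν ∂μ := by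
      refine (integral_integral_swap (f := fun ω t => φ t ω * N t ω) hφN).trans
        (Eq.trans ?_ (integral_integral_swap (f := fun ω t => φ t ω * N T ω) hφNT).symm)
      refine integral_congr_ae ?_
      filter_upwards [ae_restrict_mem measurableSet_Icc, hφNT.prod_left_ae] with t ht hti
      have e2 : μ[φ t * N T | ℱ t] =ᵐ[μ] φ t * μ[N T | ℱ t] :=
        condExp_mul_of_stronglyMeasurable_left (IsStronglyProgressive.stronglyAdapted hφp t) hti hNTi
      change ∫ ω, φ t ω * N t ω ∂μ = ∫ ω, (φ t * N T) ω ∂μ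
      rw [← integral_condExp (ℱ.le t) (f := φ t * N T)]
      refine integral_congr_ae ?_
      filter_upwards [e2, hNmart t ht] with ω h1 h2
      rw [h1, Pi.mul_apply, h2]
    rw [e1]
    have e3 : ∫ ω, ∫ t, φ t ω * N T ω ∂ν ∂μ = ∫ ω, -Φ₀ * N T ω ∂μ := by
      refine integral_congr_ae ?_
      filter_upwards [hφ0] with ω h
      rw [integral_mul_const]
      congr 1
      linarith
    rw [e3, integral_const_mul, hENT, mul_zero]
  have hM₀i : Integrable M₀ μ := by rw [hM₀]; exact integrable_condExp
  have hZi : Integrable Z μ := by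
    rw [hZ]; exact (integrable_const _).add (hM₀i.div_const T)
  set L := ∫⁻ ω, (∫⁻ t, ENNReal.ofReal ((S t ω - Z ω - N t ω) ^ 2) ∂ν) ∂μ with hL
  have hc : 0 < 1 / (2 * Λ) := by positivity
  by_cases hLtop : L = ⊤
  · rw [hLtop, EReal.coe_ennreal_top, EReal.coe_mul_top_of_pos hc, EReal.coe_add_top]
    exact le_top
  have hgm : AEStronglyMeasurable (fun p : Ω × ℝ => S p.2 p.1 - Z p.1 - N p.2 p.1) π :=
    (hSL.1.sub (hZi.1.comp_fst)).sub hNL.1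
  have hgL := aux_memLp μ ν _ hgm (lt_top_iff_ne_top.2 hLtop)
  have hgg : Integrable (fun p : Ω × ℝ => (S p.2 p.1 - Z p.1 - N p.2 p.1) ^ 2) π :=
    hgL.integrable_sq
  have hLeq : L = ENNReal.ofReal (∫ ω, ∫ t, (S t ω - Z ω - N t ω) ^ 2 ∂ν ∂μ) := by
    have := ofReal_integral_eq_lintegral_ofReal hgg
      (Filter.Eventually.of_forall fun p => sq_nonneg _)
    rw [integral_prod _ hgg, lintegral_prod _ hgg.1.aemeasurable.ennreal_ofReal] at this
    exact this.symm
  have hnn : 0 ≤ ∫ ω, ∫ t, (S t ω - Z ω - N t ω) ^ 2 ∂ν ∂μ :=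
    integral_nonneg fun ω => integral_nonneg fun t => sq_nonneg _
  rw [hLeq, EReal.coe_ennreal_ofReal, max_eq_left hnn, ← EReal.coe_mul, ← EReal.coe_add,
    EReal.coe_le_coe_iff]
  have i1 := hφS.integral_prod_left
  have i2 := hφφ.integral_prod_left
  have i3 := hgg.integral_prod_left
  have i4 := hφN.integral_prod_left
  simp only at i1 i2 i3 i4
  have hWi : Integrable (wealth T Λ Φ₀ S φ) μ :=
    ((hS0.const_mul (-Φ₀)).sub i1).sub (i2.const_mul (Λ / 2))
  have j1 : Integrable (fun ω => Φ₀ * (Z ω - S 0 ω)) μ := (hZi.sub hS0).const_mul _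
  have j2 := i3.const_mul (1 / (2 * Λ))
  have key : ∫ ω, wealth T Λ Φ₀ S φ ω ∂μ ≤ ∫ ω, ((Φ₀ * (Z ω - S 0 ω)
      + 1 / (2 * Λ) * ∫ t, (S t ω - Z ω - N t ω) ^ 2 ∂ν) - ∫ t, φ t ω * N t ω ∂ν) ∂μ := by
    refine integral_mono_ae hWi ((j1.add j2).sub i4) ?_
    filter_upwards [hφ0, hφS.prod_right_ae, hφφ.prod_right_ae, hgg.prod_right_ae,
      hφN.prod_right_ae, hφi.prod_right_ae] with ω h0 k1 k2 k3 k4 k5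
    have hpos : 0 ≤ ∫ t, ((((φ t ω * S t ω + (Λ / 2) * φ t ω ^ 2)
        + 1 / (2 * Λ) * (S t ω - Z ω - N t ω) ^ 2) - φ t ω * N t ω) - Z ω * φ t ω) ∂ν := by
      refine integral_nonneg fun t => ?_
      have : (((φ t ω * S t ω + (Λ / 2) * φ t ω ^ 2)
        + 1 / (2 * Λ) * (S t ω - Z ω - N t ω) ^ 2) - φ t ω * N t ω) - Z ω * φ t ω
        = 1 / (2 * Λ) * (Λ * φ t ω + (S t ω - Z ω - N t ω)) ^ 2 := by
        field_simp
        ring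
      simp only [Pi.zero_apply]
      rw [this]
      positivity
    have k2' := k2.const_mul (Λ / 2)
    have k3' := k3.const_mul (1 / (2 * Λ))
    have k5' := k5.const_mul (Z ω)
    have l1 : Integrable (fun t => φ t ω * S t ω + (Λ / 2) * φ t ω ^ 2) ν := k1.add k2'
    have l2 : Integrable (fun t => (φ t ω * S t ω + (Λ / 2) * φ t ω ^ 2)
        + 1 / (2 * Λ) * (S t ω - Z ω - N t ω) ^ 2) ν := l1.add k3'
    have l3 : Integrable (fun t => ((φ t ω * S t ω + (Λ / 2) * φ t ω ^ 2)
        + 1 / (2 * Λ) * (S t ω - Z ω - N t ω) ^ 2) - φ t ω * N t ω) ν := l2.sub k4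
    rw [integral_sub l3 k5', integral_sub l2 k4, integral_add l1 k3', integral_add k1 k2', integral_const_mul, integral_const_mul,
      integral_const_mul] at hpos
    have h0' : ∫ t, φ t ω ∂ν = -Φ₀ := by linarith
    rw [h0'] at hpos
    simp only [wealth]
    linarith
  have j3 : Integrable (fun ω => Φ₀ * (Z ω - S 0 ω)
      + 1 / (2 * Λ) * ∫ t, (S t ω - Z ω - N t ω) ^ 2 ∂ν) μ := j1.add j2
  rw [integral_sub j3 i4, integral_add j1 j2, integral_const_mul, integral_const_mul,
    hφNzero] at key
  linarith
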